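/- arXiv:2408.14394 — 5 statements merged into one kernel-verified Lean document; each statement's English description precedes it below -/
import Mathlib

section
/- Let (X, P(X)) and (Y, P(Y)) be rectifiable, zigzag connected d-spaces such that (X, dZ^X) and (Y, dZ^Y) are nonempty compact metric spaces. Then for every ε > 0 there exist a metric space Z equipped with a rectifiable d-structure P(Z) (with induced zigzag distance dZ^Z) and d-isometries F : X → Z and G : Y → Z such that the Hausdorff distance (with respect to dZ^Z) between F(X) and G(Y) is at most d_GH((X, dZ^X), (Y, dZ^Y)) + ε. -/
open scoped ENNReal

noncomputable section

/-- The length of a path `γ : ℝ → X`: its total variation on `[0,1]`. -/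
def pathLen {X : Type*} [PseudoEMetricSpace X] (γ : ℝ → X) : ℝ≥0∞ :=
  eVariationOn γ (Set.Icc 0 1)

/-- `P` is a d-space structure on `X`: it contains all constant paths, is closed under
precomposition with continuous nondecreasing maps `[0,1] → [0,1]`, and is closed under
concatenation; all members are continuous on `[0,1]`. -/
structure IsDSpace {X : Type*} [MetricSpace X] (P : Set (ℝ → X)) : Prop where
  cont : ∀ γ ∈ P, ContinuousOn γ (Set.Icc (0:ℝ) 1)
  const_mem : ∀ x : X, (fun _ : ℝ => x) ∈ P
  reparam : ∀ γ ∈ P, ∀ h : ℝ → ℝ, ContinuousOn h (Set.Icc (0:ℝ) 1) →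
    MonotoneOn h (Set.Icc (0:ℝ) 1) → Set.MapsTo h (Set.Icc (0:ℝ) 1) (Set.Icc (0:ℝ) 1) →
    γ ∘ h ∈ P
  concat : ∀ γ ∈ P, ∀ γ' ∈ P, γ 1 = γ' 0 →
    (fun t : ℝ => if t ≤ 1/2 then γ (2*t) else γ' (2*t - 1)) ∈ P

/-- A d-structure is rectifiable if every d-path has finite length. -/
def IsRectifiable {X : Type*} [MetricSpace X] (P : Set (ℝ → X)) : Prop :=
  ∀ γ ∈ P, pathLen γ ≠ ⊤

/-- `γ` is a d-path from `x` to `x'`. -/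
def IsDPathFrom {X : Type*} (P : Set (ℝ → X)) (x x' : X) (γ : ℝ → X) : Prop :=
  γ ∈ P ∧ γ 0 = x ∧ γ 1 = x'

/-- `L` is a zigzag path between `x` and `x'`: a finite sequence of d-paths, each joining
consecutive points `p i`, `p (i+1)` in one direction or the other. -/
def IsZigzagFrom {X : Type*} (P : Set (ℝ → X)) (x x' : X) (L : List (ℝ → X)) : Prop :=
  ∃ p : ℕ → X, p 0 = x ∧ p L.length = x' ∧
    ∀ i : Fin L.length,
      IsDPathFrom P (p i) (p (i + 1)) (L.get i) ∨ IsDPathFrom P (p (i + 1)) (p i) (L.get i)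

/-- The length of a zigzag path: the sum of the lengths of its pieces. -/
def zigzagLen {X : Type*} [PseudoEMetricSpace X] (L : List (ℝ → X)) : ℝ≥0∞ :=
  (L.map pathLen).sum

/-- The zigzag (extended) distance induced by a d-structure `P`. -/
def zzDist {X : Type*} [MetricSpace X] (P : Set (ℝ → X)) (x x' : X) : ℝ≥0∞ :=
  ⨅ L ∈ {L : List (ℝ → X) | IsZigzagFrom P x x' L}, zigzagLen L

/-- Any two points are joined by a zigzag path. -/
def ZigzagConnected {X : Type*} (P : Set (ℝ → X)) : Prop :=
  ∀ x x' : X, ∃ L, IsZigzagFrom P x x' L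

/-- A d-map: continuous and sending d-paths to d-paths. -/
def IsDMap {X Y : Type*} [MetricSpace X] [MetricSpace Y]
    (PX : Set (ℝ → X)) (PY : Set (ℝ → Y)) (F : X → Y) : Prop :=
  Continuous F ∧ ∀ γ ∈ PX, F ∘ γ ∈ PY

/-- The reversed d-structure: `γ ∈ reverseP P` iff `t ↦ γ (1 - t)` belongs to `P`. -/
def reverseP {X : Type*} (P : Set (ℝ → X)) : Set (ℝ → X) :=
  {γ | (fun t => γ (1 - t)) ∈ P}

/-- `|a - b|` for extended nonnegative reals. -/
def ediffAbs (a b : ℝ≥0∞) : ℝ≥0∞ := (a - b) ⊔ (b - a)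

/-- Distortion of a map with respect to extended distances on source and target. -/
def edis {X Y : Type*} (dX : X → X → ℝ≥0∞) (dY : Y → Y → ℝ≥0∞) (F : X → Y) : ℝ≥0∞ :=
  ⨆ x : X, ⨆ x' : X, ediffAbs (dX x x') (dY (F x) (F x'))

/-- Codistortion of a pair of maps with respect to extended distances. -/
def ecodis {X Y : Type*} (dX : X → X → ℝ≥0∞) (dY : Y → Y → ℝ≥0∞)
    (F : X → Y) (G : Y → X) : ℝ≥0∞ :=
  ⨆ x : X, ⨆ y : Y, ediffAbs (dX x (G y)) (dY (F x) y)

/-- The distortion distance between two d-spaces: half the infimum, over pairs of d-maps,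
of the maximum of the two distortions and the codistortion (w.r.t. zigzag distances). -/
def ddis {X Y : Type*} [MetricSpace X] [MetricSpace Y]
    (PX : Set (ℝ → X)) (PY : Set (ℝ → Y)) : ℝ≥0∞ :=
  (1/2 : ℝ≥0∞) * ⨅ (F : {F : X → Y // IsDMap PX PY F}) (G : {G : Y → X // IsDMap PY PX G}),
    max (edis (zzDist PX) (zzDist PY) F.1)
      (max (edis (zzDist PY) (zzDist PX) G.1) (ecodis (zzDist PX) (zzDist PY) F.1 G.1))

/-- A d-correspondence: a relation with surjective projections that matches reachability. -/
def IsDCorrespondence {X Y : Type*} (PX : Set (ℝ → X)) (PY : Set (ℝ → Y))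
    (R : Set (X × Y)) : Prop :=
  (∀ x : X, ∃ y : Y, (x, y) ∈ R) ∧ (∀ y : Y, ∃ x : X, (x, y) ∈ R) ∧
  ∀ p ∈ R, ∀ q ∈ R,
    ((∃ γ, IsDPathFrom PX p.1 q.1 γ) ↔ (∃ γ, IsDPathFrom PY p.2 q.2 γ))

/-- Distortion of a correspondence with respect to the zigzag distances. -/
def corDis {X Y : Type*} [MetricSpace X] [MetricSpace Y]
    (PX : Set (ℝ → X)) (PY : Set (ℝ → Y)) (R : Set (X × Y)) : ℝ≥0∞ :=
  ⨆ p : R, ⨆ q : R, ediffAbs (zzDist PX p.1.1 q.1.1) (zzDist PY p.1.2 q.1.2)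

/-- The d-correspondence distortion distance. -/
def dcdis {X Y : Type*} [MetricSpace X] [MetricSpace Y]
    (PX : Set (ℝ → X)) (PY : Set (ℝ → Y)) : ℝ≥0∞ :=
  (1/2 : ℝ≥0∞) * ⨅ R : {R : Set (X × Y) // IsDCorrespondence PX PY R}, corDis PX PY R.1

/-- Hausdorff distance between two subsets w.r.t. an extended distance. -/
def ehausdorffDist {Z : Type*} (d : Z → Z → ℝ≥0∞) (s t : Set Z) : ℝ≥0∞ :=
  max (⨆ a ∈ s, ⨅ b ∈ t, d a b) (⨆ b ∈ t, ⨅ a ∈ s, d a b)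

universe u v

open Set

section Variation

variable {V W : Type*} [PseudoEMetricSpace V] [PseudoEMetricSpace W]

/-- A pointwise bound on increments bounds the variation. -/
theorem eVariationOn_le_of_edist_le {f : ℝ → V} {g : ℝ → W} {s : Set ℝ}
    (h : ∀ a ∈ s, ∀ b ∈ s, edist (f a) (f b) ≤ edist (g a) (g b)) :
    eVariationOn f s ≤ eVariationOn g s :=
  iSup_mono fun q => Finset.sum_le_sum fun _ _ => h _ (q.2.2.2 _) _ (q.2.2.2 _)

theorem eVariationOn_Icc_add (f : ℝ → V) {a b c : ℝ} (hab : a ≤ b) (hbc : b ≤ c) :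
    eVariationOn f (Icc a b) + eVariationOn f (Icc b c) = eVariationOn f (Icc a c) := by
  simpa using eVariationOn.Icc_add_Icc f (s := univ) hab hbc (mem_univ b)

/-- For a continuous path, increments have to be compared only at small scale in order to
compare variations. -/
theorem eVariationOn_le_of_local {X : Type*} [MetricSpace X] {f : ℝ → X} {g : ℝ → W} {L a b : ℝ}
    (hL : 0 < L) (hf : ContinuousOn f (Icc a b)) (hab : a ≤ b)
    (h : ∀ x ∈ Icc a b, ∀ y ∈ Icc a b, dist (f x) (f y) < L →
      edist (f x) (f y) ≤ edist (g x) (g y)) :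
    eVariationOn f (Icc a b) ≤ eVariationOn g (Icc a b) := by
  obtain ⟨δ, hδ, hu⟩ := Metric.uniformContinuousOn_iff.1
    (isCompact_Icc.uniformContinuousOn_of_continuous hf) L hL
  have key : ∀ n : ℕ, ∀ x y, a ≤ x → x ≤ y → y ≤ b → y - x ≤ n * (δ / 2) →
      eVariationOn f (Icc x y) ≤ eVariationOn g (Icc x y) := by
    intro n
    induction n with
    | zero =>
      intro x y _ hxy _ hn
      have : x = y := by simp at hn; linarith
      subst this
      simp [eVariationOn.subsingleton]
    | succ n ih =>
      intro x y hx hxy hy hn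
      push_cast at hn
      set m := min y (x + δ / 2)
      have h1 : x ≤ m := le_min hxy (by linarith)
      have h2 : m ≤ y := min_le_left _ _
      have h3 : m ≤ x + δ / 2 := min_le_right _ _
      rw [← eVariationOn_Icc_add f h1 h2, ← eVariationOn_Icc_add g h1 h2]
      refine add_le_add (eVariationOn_le_of_edist_le fun c hc d hd => ?_)
        (ih m y (hx.trans h1) h2 hy ?_)
      · have hc' : c ∈ Icc a b := ⟨hx.trans hc.1, hc.2.trans (h2.trans hy)⟩
        have hd' : d ∈ Icc a b := ⟨hx.trans hd.1, hd.2.trans (h2.trans hy)⟩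
        refine h c hc' d hd' (hu c hc' d hd' ?_)
        rw [Real.dist_eq, abs_lt]
        constructor <;> linarith [hc.1, hc.2, hd.1, hd.2]
      · rcases min_cases y (x + δ / 2) with ⟨h4, _⟩ | ⟨h4, _⟩
        · have : m = y := h4
          rw [this, sub_self]
          positivity
        · have : m = x + δ / 2 := h4
          rw [this]
          linarith
  obtain ⟨n, hn⟩ := exists_nat_ge ((b - a) / (δ / 2))
  exact key n a b le_rfl hab le_rfl ((div_le_iff₀ (by positivity)).1 hn)

end Variation

section Zigzag

/-- The zigzag distance between the endpoints of a piece of a d-path is at most its length. -/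
theorem zzDist_le_eVariationOn {X : Type*} [MetricSpace X] {P : Set (ℝ → X)} (hP : IsDSpace P)
    {γ : ℝ → X} (hγ : γ ∈ P) {s t : ℝ} (hs : 0 ≤ s) (hst : s ≤ t) (ht : t ≤ 1) :
    zzDist P (γ s) (γ t) ≤ eVariationOn γ (Icc s t) := by
  set h : ℝ → ℝ := fun u => s + u * (t - s)
  have hmono : Monotone h := fun u v huv => by
    have := mul_le_mul_of_nonneg_right huv (sub_nonneg.2 hst)
    simp only [h]; linarith
  have hmaps : MapsTo h (Icc 0 1) (Icc s t) := fun u hu => by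
    constructor <;> simp only [h] <;> nlinarith [hu.1, hu.2]
  have hmem : γ ∘ h ∈ P := hP.reparam γ hγ h (by fun_prop) (hmono.monotoneOn _)
    (hmaps.mono_right (Icc_subset_Icc hs ht))
  have hz : IsZigzagFrom P (γ s) (γ t) [γ ∘ h] := by
    refine ⟨fun i => if i = 0 then γ s else γ t, by simp, by simp, fun i => Or.inl ?_⟩
    obtain ⟨i, hi⟩ := i
    obtain rfl : i = 0 := by simpa using hi
    exact ⟨hmem, by simp [h], by simp [h]⟩
  refine (iInf₂_le [γ ∘ h] hz).trans ?_
  simpa [zigzagLen] using! eVariationOn.comp_le_of_monotoneOn γ h (hmono.monotoneOn _) hmaps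

/-- A map of paths that does not increase lengths does not increase the zigzag distance. -/
theorem zzDist_map_le {X W : Type*} [MetricSpace X] [MetricSpace W] {P : Set (ℝ → X)}
    {Q : Set (ℝ → W)} {F : X → W} (hF : ∀ γ ∈ P, F ∘ γ ∈ Q)
    (hlen : ∀ γ : ℝ → X, pathLen (F ∘ γ) ≤ pathLen γ) (x x' : X) :
    zzDist Q (F x) (F x') ≤ zzDist P x x' := by
  refine le_iInf₂ fun L hL => ?_
  obtain ⟨p, h0, h1, hp⟩ := hL
  have hz : IsZigzagFrom Q (F x) (F x') (L.map fun γ => F ∘ γ) := by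
    refine ⟨F ∘ p, by simp [h0], by simp [h1], fun i => ?_⟩
    have hi : (i : ℕ) < L.length := by simpa using i.2
    have hget : (L.map fun γ => F ∘ γ).get i = F ∘ L.get ⟨i, hi⟩ := by simp
    rw [hget]
    rcases hp ⟨i, hi⟩ with ⟨h, h0, h1⟩ | ⟨h, h0, h1⟩
    · exact Or.inl ⟨hF _ h, by simpa using congrArg F h0, by simpa using congrArg F h1⟩
    · exact Or.inr ⟨hF _ h, by simpa using congrArg F h0, by simpa using congrArg F h1⟩
  refine (iInf₂_le _ hz).trans ?_
  simp only [zigzagLen, List.map_map]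
  exact List.sum_le_sum fun γ _ => hlen γ

/-- If `p` does not stretch d-paths, it does not increase the zigzag distance. -/
theorem edist_le_zzDist {W E : Type*} [MetricSpace W] [PseudoEMetricSpace E] {Q : Set (ℝ → W)}
    {p : W → E} (hp : ∀ γ ∈ Q, edist (p (γ 0)) (p (γ 1)) ≤ pathLen γ) (w w' : W) :
    edist (p w) (p w') ≤ zzDist Q w w' := by
  refine le_iInf₂ fun L hL => ?_
  obtain ⟨q, rfl, rfl, hq⟩ := hL
  refine (edist_le_range_sum_edist (p ∘ q) L.length).trans ?_
  rw [Finset.sum_range, zigzagLen, ← Fin.sum_univ_fun_getElem]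
  refine Finset.sum_le_sum fun i _ => ?_
  rcases hq i with ⟨h, h0, h1⟩ | ⟨h, h0, h1⟩
  · simpa [h0, h1] using hp _ h
  · rw [edist_comm]
    simpa [h0, h1] using hp _ h

end Zigzag

section ControlledPaths

variable {W E : Type*} [MetricSpace W] [PseudoEMetricSpace E]

/-- The rectifiable paths along which `p` is nonexpanding from arc length to the distance
of `E`. -/
def controlledPaths (p : W → E) : Set (ℝ → W) :=
  {γ | ContinuousOn γ (Icc 0 1) ∧ pathLen γ ≠ ⊤ ∧ ∀ s t, 0 ≤ s → s ≤ t → t ≤ 1 →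
    edist (p (γ s)) (p (γ t)) ≤ eVariationOn γ (Icc s t)}

theorem edist_comp_le_of_mem_controlledPaths {p : W → E} {γ : ℝ → W}
    (hγ : γ ∈ controlledPaths p) {h : ℝ → ℝ} {s t : ℝ} (hst : s ≤ t)
    (hc : ContinuousOn h (Icc s t)) (hm : MonotoneOn h (Icc s t))
    (hs : 0 ≤ h s) (ht : h t ≤ 1) :
    edist (p (γ (h s))) (p (γ (h t))) ≤ eVariationOn (γ ∘ h) (Icc s t) := by
  rw [eVariationOn.comp_eq_of_monotoneOn _ _ hm]
  exact (hγ.2.2 _ _ hs (hm ⟨le_rfl, hst⟩ ⟨hst, le_rfl⟩ hst) ht).trans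
    (eVariationOn.mono _ (intermediate_value_Icc hst hc))

theorem isDSpace_controlledPaths (p : W → E) : IsDSpace (controlledPaths p) where
  cont γ hγ := hγ.1
  const_mem x := by
    refine ⟨continuousOn_const, ?_, fun s t _ _ _ => by simp⟩
    rw [pathLen, eVariationOn.constant_on (by rintro _ ⟨_, _, rfl⟩ _ ⟨_, _, rfl⟩; rfl)]
    simp
  reparam γ hγ h hc hm hmaps := by
    refine ⟨hγ.1.comp hc hmaps, ?_, fun s t hs hst ht => ?_⟩
    · exact ne_top_of_le_ne_top hγ.2.1 (eVariationOn.comp_le_of_monotoneOn γ h hm hmaps)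
    · have hsub : Icc s t ⊆ Icc 0 1 := Icc_subset_Icc hs ht
      exact edist_comp_le_of_mem_controlledPaths hγ hst (hc.mono hsub) (hm.mono hsub)
        (hmaps ⟨hs, hst.trans ht⟩).1 (hmaps ⟨hs.trans hst, ht⟩).2
  concat γ hγ γ' hγ' heq := by
    set c : ℝ → W := fun t => if t ≤ 1 / 2 then γ (2 * t) else γ' (2 * t - 1)
    set h₁ : ℝ → ℝ := fun t => 2 * t with hh₁
    set h₂ : ℝ → ℝ := fun t => 2 * t - 1 with hh₂
    have hm₁ : Monotone h₁ := fun u v huv => by simp only [h₁]; linarith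
    have hm₂ : Monotone h₂ := fun u v huv => by simp only [h₂]; linarith
    have hk₁ : Continuous h₁ := by fun_prop
    have hk₂ : Continuous h₂ := by fun_prop
    have hmaps₁ : MapsTo h₁ (Icc 0 (1 / 2)) (Icc 0 1) := fun u hu => by
      constructor <;> simp only [h₁] <;> linarith [hu.1, hu.2]
    have hmaps₂ : MapsTo h₂ (Icc (1 / 2) 1) (Icc 0 1) := fun u hu => by
      constructor <;> simp only [h₂] <;> linarith [hu.1, hu.2]
    have e₁ : EqOn c (γ ∘ h₁) (Iic (1 / 2)) := fun u hu => if_pos hu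
    have e₂ : EqOn c (γ' ∘ h₂) (Ici (1 / 2)) := fun u hu => by
      rcases eq_or_lt_of_le (show (1 / 2 : ℝ) ≤ u from hu) with rfl | hlt
      · simpa [c, h₂] using heq
      · exact if_neg hlt.not_ge
    have l₁ : ∀ s t, 0 ≤ s → s ≤ t → t ≤ 1 / 2 →
        edist (p (c s)) (p (c t)) ≤ eVariationOn c (Icc s t) := fun s t hs hst ht => by
      rw [eVariationOn.eq_of_eqOn (e₁.mono fun u hu => hu.2.trans ht), e₁ (hst.trans ht), e₁ ht]
      exact edist_comp_le_of_mem_controlledPaths hγ hst hk₁.continuousOn (hm₁.monotoneOn _)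
        (hmaps₁ ⟨hs, hst.trans ht⟩).1 (hmaps₁ ⟨hs.trans hst, ht⟩).2
    have l₂ : ∀ s t, 1 / 2 ≤ s → s ≤ t → t ≤ 1 →
        edist (p (c s)) (p (c t)) ≤ eVariationOn c (Icc s t) := fun s t hs hst ht => by
      rw [eVariationOn.eq_of_eqOn (e₂.mono fun u hu => hs.trans hu.1), e₂ hs, e₂ (hs.trans hst)]
      exact edist_comp_le_of_mem_controlledPaths hγ' hst hk₂.continuousOn (hm₂.monotoneOn _)
        (hmaps₂ ⟨hs, hst.trans ht⟩).1 (hmaps₂ ⟨hs.trans hst, ht⟩).2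
    refine ⟨?_, ?_, fun s t hs hst ht => ?_⟩
    · rw [← Icc_union_Icc_eq_Icc (show (0 : ℝ) ≤ 1 / 2 by norm_num) (by norm_num)]
      refine ContinuousOn.union_of_isClosed ?_ ?_ isClosed_Icc isClosed_Icc
      · exact (hγ.1.comp hk₁.continuousOn hmaps₁).congr (e₁.mono fun u hu => hu.2)
      · exact (hγ'.1.comp hk₂.continuousOn hmaps₂).congr (e₂.mono fun u hu => hu.1)
    · rw [pathLen, ← eVariationOn_Icc_add c (show (0 : ℝ) ≤ 1 / 2 by norm_num) (by norm_num),
        eVariationOn.eq_of_eqOn (e₁.mono fun u hu => hu.2),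
        eVariationOn.eq_of_eqOn (e₂.mono fun u hu => hu.1)]
      refine ENNReal.add_ne_top.2 ⟨ne_top_of_le_ne_top hγ.2.1 ?_, ne_top_of_le_ne_top hγ'.2.1 ?_⟩
      · exact eVariationOn.comp_le_of_monotoneOn γ h₁ (hm₁.monotoneOn _) hmaps₁
      · exact eVariationOn.comp_le_of_monotoneOn γ' h₂ (hm₂.monotoneOn _) hmaps₂
    · rcases le_total t (1 / 2) with h | h
      · exact l₁ s t hs hst h
      rcases le_total (1 / 2) s with h' | h'
      · exact l₂ s t h' hst ht
      rw [← eVariationOn_Icc_add c h' h]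
      exact (edist_triangle _ (p (c (1 / 2))) _).trans
        (add_le_add (l₁ _ _ hs h' le_rfl) (l₂ _ _ le_rfl h ht))

theorem isRectifiable_controlledPaths (p : W → E) : IsRectifiable (controlledPaths p) :=
  fun _ hγ => hγ.2.1

theorem edist_le_zzDist_controlledPaths (p : W → E) (w w' : W) :
    edist (p w) (p w') ≤ zzDist (controlledPaths p) w w' :=
  edist_le_zzDist (fun _ hγ => hγ.2.2 0 1 le_rfl zero_le_one le_rfl) w w'

/-- A short map that is isometric at small scale and becomes, after composition with `p`,
isometric for the zigzag distance, is a d-isometry into the controlled paths. -/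
theorem isDMap_and_zzDist_eq {X : Type*} [MetricSpace X] {P : Set (ℝ → X)} (hP : IsDSpace P)
    (hr : IsRectifiable P) {p : W → E} {F : X → W} {L : ℝ} (hL : 0 < L)
    (hF : ∀ x x', dist (F x) (F x') = min (dist x x') L)
    (hpF : ∀ x x', edist (p (F x)) (p (F x')) = zzDist P x x') :
    IsDMap P (controlledPaths p) F ∧
      ∀ x x', zzDist (controlledPaths p) (F x) (F x') = zzDist P x x' := by
  have hle : ∀ x x', edist (F x) (F x') ≤ edist x x' := fun x x' => by
    rw [edist_dist, edist_dist, hF]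
    exact ENNReal.ofReal_le_ofReal (min_le_left _ _)
  have hcont : Continuous F :=
    LipschitzWith.continuous (K := 1) fun x x' => by simpa using hle x x'
  have hlen : ∀ γ : ℝ → X, pathLen (F ∘ γ) ≤ pathLen γ := fun γ =>
    eVariationOn_le_of_edist_le fun a _ b _ => hle _ _
  have hmem : ∀ γ ∈ P, F ∘ γ ∈ controlledPaths p := fun γ hγ => by
    refine ⟨hcont.comp_continuousOn (hP.cont γ hγ), ne_top_of_le_ne_top (hr γ hγ) (hlen γ),
      fun s t hs hst ht => ?_⟩
    simp only [Function.comp_apply, hpF]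
    refine (zzDist_le_eVariationOn hP hγ hs hst ht).trans ?_
    refine eVariationOn_le_of_local hL ((hP.cont γ hγ).mono (Icc_subset_Icc hs ht)) hst ?_
    intro a _ b _ hab
    rw [Function.comp_apply, Function.comp_apply, edist_dist, edist_dist, hF, min_eq_left hab.le]
  refine ⟨⟨hcont, hmem⟩, fun x x' => le_antisymm (zzDist_map_le hmem hlen x x') ?_⟩
  rw [← hpF]
  exact edist_le_zzDist_controlledPaths p _ _

/-- A path that is an isometry up to the factor `L`, and along which `p` is `L`-Lipschitz,
bounds the zigzag distance of its endpoints by `L`. -/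
theorem zzDist_controlledPaths_le {p : W → E} {e : ℝ → W} {L : ℝ}
    (he : ∀ s ∈ Icc (0 : ℝ) 1, ∀ t ∈ Icc (0 : ℝ) 1, dist (e s) (e t) = L * |s - t|)
    (hp : ∀ s ∈ Icc (0 : ℝ) 1, ∀ t ∈ Icc (0 : ℝ) 1,
      edist (p (e s)) (p (e t)) ≤ ENNReal.ofReal (L * |s - t|)) :
    zzDist (controlledPaths p) (e 0) (e 1) ≤ ENNReal.ofReal L := by
  have hL : 0 ≤ L := by
    have := he 0 (by simp) 1 (by simp)
    simp at this
    rw [← this]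
    exact dist_nonneg
  have hlip : LipschitzOnWith ⟨L, hL⟩ e (Icc 0 1) :=
    LipschitzOnWith.of_dist_le_mul fun s hs t ht => (he s hs t ht).le
  have hlen : pathLen e ≤ ENNReal.ofReal L := by
    have h1 := hlip.comp_eVariationOn_le (g := id) (mapsTo_id (Icc (0 : ℝ) 1))
    have h2 : eVariationOn (id : ℝ → ℝ) (Icc 0 1) = 1 := by simp
    rw [h2, mul_one] at h1
    rw [ENNReal.ofReal_eq_coe_nnreal hL]
    exact h1
  have hmem : e ∈ controlledPaths p := by
    refine ⟨hlip.continuousOn, ne_top_of_le_ne_top ENNReal.ofReal_ne_top hlen,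
      fun s t hs hst ht => ?_⟩
    have hs' : s ∈ Icc (0 : ℝ) 1 := ⟨hs, hst.trans ht⟩
    have ht' : t ∈ Icc (0 : ℝ) 1 := ⟨hs.trans hst, ht⟩
    refine (hp s hs' t ht').trans ?_
    rw [← he s hs' t ht', ← edist_dist]
    exact eVariationOn.edist_le e ⟨le_rfl, hst⟩ ⟨hst, le_rfl⟩
  have hz : IsZigzagFrom (controlledPaths p) (e 0) (e 1) [e] := by
    refine ⟨fun i => e i, by simp, by simp, fun i => Or.inl ?_⟩
    obtain ⟨i, hi⟩ := i
    obtain rfl : i = 0 := by simpa using hi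
    exact ⟨hmem, by simp, by simp⟩
  exact (iInf₂_le [e] hz).trans (by simpa [zigzagLen] using hlen)

end ControlledPaths

section Join

/-- The topological join of `X` and `Y`, where the collapsed coordinates are normalized to
base points. -/
def Join {X : Type u} {Y : Type v} (x₀ : X) (y₀ : Y) : Type (max u v) :=
  {w : X × Y × ℝ // (0 ≤ w.2.2 ∧ w.2.2 ≤ 1) ∧ (w.2.2 = 1 → w.1 = x₀) ∧ (w.2.2 = 0 → w.2.1 = y₀)}

variable {X : Type u} {Y : Type v}

/-- The inclusion of `X` in the join. -/
def joinInl (x₀ : X) (y₀ : Y) (x : X) : Join x₀ y₀ :=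
  ⟨(x, y₀, 0), by simp⟩

/-- The inclusion of `Y` in the join. -/
def joinInr (x₀ : X) (y₀ : Y) (y : Y) : Join x₀ y₀ :=
  ⟨(x₀, y, 1), by simp⟩

open Classical in
/-- The segment of the join between `x` and `y`, constant outside `[0, 1]`. -/
def joinSegment (x₀ : X) (y₀ : Y) (x : X) (y : Y) (t : ℝ) : Join x₀ y₀ :=
  let s : Icc (0 : ℝ) 1 := projIcc 0 1 zero_le_one t
  ⟨(if (s : ℝ) = 1 then x₀ else x, if (s : ℝ) = 0 then y₀ else y, s), s.2,
    fun h => if_pos h, fun h => if_pos h⟩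

theorem joinSegment_zero (x₀ : X) (y₀ : Y) (x : X) (y : Y) :
    joinSegment x₀ y₀ x y 0 = joinInl x₀ y₀ x :=
  Subtype.ext (by simp [joinSegment, joinInl])

theorem joinSegment_one (x₀ : X) (y₀ : Y) (x : X) (y : Y) :
    joinSegment x₀ y₀ x y 1 = joinInr x₀ y₀ y :=
  Subtype.ext (by simp [joinSegment, joinInr])

variable {E : Type*} [NormedAddCommGroup E] [NormedSpace ℝ E]

/-- The affine extension to the join of maps from `X` and `Y` to a normed space. -/
def joinLift (x₀ : X) (y₀ : Y) (f : X → E) (g : Y → E) (w : Join x₀ y₀) : E :=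
  (1 - w.1.2.2) • f w.1.1 + w.1.2.2 • g w.1.2.1

theorem joinLift_joinInl (x₀ : X) (y₀ : Y) (f : X → E) (g : Y → E) (x : X) :
    joinLift x₀ y₀ f g (joinInl x₀ y₀ x) = f x := by
  simp [joinLift, joinInl]

theorem joinLift_joinInr (x₀ : X) (y₀ : Y) (f : X → E) (g : Y → E) (y : Y) :
    joinLift x₀ y₀ f g (joinInr x₀ y₀ y) = g y := by
  simp [joinLift, joinInr]

theorem joinLift_joinSegment (x₀ : X) (y₀ : Y) (f : X → E) (g : Y → E) (x : X) (y : Y) {s : ℝ}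
    (hs : s ∈ Icc (0 : ℝ) 1) :
    joinLift x₀ y₀ f g (joinSegment x₀ y₀ x y s) = (1 - s) • f x + s • g y := by
  simp only [joinLift, joinSegment, projIcc_of_mem zero_le_one hs]
  congr 1
  · by_cases h : s = 1 <;> simp [h]
  · by_cases h : s = 0 <;> simp [h]

theorem edist_joinLift_joinSegment_le (x₀ : X) (y₀ : Y) (f : X → E) (g : Y → E) {x : X} {y : Y}
    {L s t : ℝ} (hxy : dist (f x) (g y) ≤ L) (hs : s ∈ Icc (0 : ℝ) 1) (ht : t ∈ Icc (0 : ℝ) 1) :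
    edist (joinLift x₀ y₀ f g (joinSegment x₀ y₀ x y s))
      (joinLift x₀ y₀ f g (joinSegment x₀ y₀ x y t)) ≤ ENNReal.ofReal (L * |s - t|) := by
  rw [edist_dist, joinLift_joinSegment _ _ _ _ _ _ hs, joinLift_joinSegment _ _ _ _ _ _ ht]
  refine ENNReal.ofReal_le_ofReal ?_
  have : ((1 - s) • f x + s • g y) - ((1 - t) • f x + t • g y) = (t - s) • (f x - g y) := by
    module
  rw [dist_eq_norm, this, norm_smul, ← dist_eq_norm (f x), Real.norm_eq_abs, abs_sub_comm,
    mul_comm]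
  exact mul_le_mul_of_nonneg_right hxy (abs_nonneg _)

/-- The metric of a cone over a metric truncated at `2 * c` satisfies the triangle
inequality. -/
theorem cone_triangle {c s t r a b d : ℝ} (hs : 0 ≤ s) (ht : 0 ≤ t) (hr : 0 ≤ r)
    (ha : 0 ≤ a) (hb : 0 ≤ b) (hd : d ≤ 2 * c) (had : d ≤ a + b) (hd0 : 0 ≤ d) :
    c * |s - r| + min s r * d ≤
      (c * |s - t| + min s t * a) + (c * |t - r| + min t r * b) := by
  have hc : 0 ≤ c := by linarith
  have h1 : |s - r| ≤ |s - t| + |t - r| := abs_sub_le s t r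
  by_cases hm : min s r ≤ t
  · have h2 : min s r ≤ min s t := le_min (min_le_left _ _) hm
    have h3 : min s r ≤ min t r := le_min hm (min_le_right _ _)
    have h0 : 0 ≤ min s r := le_min hs hr
    nlinarith [mul_le_mul_of_nonneg_left h1 hc, mul_le_mul_of_nonneg_right h2 ha,
      mul_le_mul_of_nonneg_right h3 hb, mul_le_mul_of_nonneg_left had h0]
  · push Not at hm
    have hts : t < s := hm.trans_le (min_le_left _ _)
    have htr : t < r := hm.trans_le (min_le_right _ _)
    have h4 : |s - r| = s + r - 2 * min s r := by
      rcases le_total s r with h | h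
      · rw [min_eq_left h, abs_of_nonpos (by linarith)]; ring
      · rw [min_eq_right h, abs_of_nonneg (by linarith)]; ring
    rw [h4, min_eq_right hts.le, min_eq_left htr.le, abs_of_pos (by linarith),
      abs_of_neg (by linarith)]
    nlinarith [mul_le_mul_of_nonneg_left had ht,
      mul_le_mul_of_nonneg_left hd (sub_nonneg.2 hm.le)]

theorem min_dist_triangle {X : Type*} [MetricSpace X] {L : ℝ} (hL : 0 ≤ L) (x y z : X) :
    min (dist x z) L ≤ min (dist x y) L + min (dist y z) L := by
  have := dist_triangle x y z
  have h1 := dist_nonneg (x := x) (y := y)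
  have h2 := dist_nonneg (x := y) (y := z)
  rcases min_cases (dist x z) L with h | h <;> rcases min_cases (dist x y) L with h' | h' <;>
    rcases min_cases (dist y z) L with h'' | h'' <;> linarith

variable [MetricSpace X] [MetricSpace Y]

/-- The sum of the two cone metrics on the join, for the metrics of `X` and `Y` truncated
at `L`. -/
def joinDist {x₀ : X} {y₀ : Y} (L : ℝ) (w w' : Join x₀ y₀) : ℝ :=
  (L / 2 * |(1 - w.1.2.2) - (1 - w'.1.2.2)| +
    min (1 - w.1.2.2) (1 - w'.1.2.2) * min (dist w.1.1 w'.1.1) L) +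
  (L / 2 * |w.1.2.2 - w'.1.2.2| + min w.1.2.2 w'.1.2.2 * min (dist w.1.2.1 w'.1.2.1) L)

/-- A metric on the join for which the segments between `X` and `Y` have length `L` and the
inclusions of `X` and `Y` are isometric up to truncation at `L`. -/
@[reducible]
def joinMetric (x₀ : X) (y₀ : Y) {L : ℝ} (hL : 0 < L) : MetricSpace (Join x₀ y₀) where
  dist := joinDist L
  dist_self w := by simp [joinDist, hL.le]
  dist_comm w w' := by
    simp only [joinDist]
    rw [abs_sub_comm, abs_sub_comm w.1.2.2, dist_comm, dist_comm w.1.2.1, min_comm (1 - w.1.2.2),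
      min_comm w.1.2.2]
  dist_triangle u w z := by
    have := cone_triangle (c := L / 2) (sub_nonneg.2 u.2.1.2) (sub_nonneg.2 w.2.1.2)
      (sub_nonneg.2 z.2.1.2) (le_min (dist_nonneg (x := u.1.1) (y := w.1.1)) hL.le)
      (le_min (dist_nonneg (x := w.1.1) (y := z.1.1)) hL.le)
      ((min_le_right _ _).trans (by linarith)) (min_dist_triangle hL.le u.1.1 w.1.1 z.1.1)
      (le_min dist_nonneg hL.le)
    have := cone_triangle (c := L / 2) u.2.1.1 w.2.1.1 z.2.1.1
      (le_min (dist_nonneg (x := u.1.2.1) (y := w.1.2.1)) hL.le)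
      (le_min (dist_nonneg (x := w.1.2.1) (y := z.1.2.1)) hL.le)
      ((min_le_right _ _).trans (by linarith)) (min_dist_triangle hL.le u.1.2.1 w.1.2.1 z.1.2.1)
      (le_min dist_nonneg hL.le)
    simp only [joinDist]
    linarith
  eq_of_dist_eq_zero := by
    rintro ⟨⟨x, y, t⟩, ⟨ht0, ht1⟩, hx, hy⟩ ⟨⟨x', y', t'⟩, ⟨ht0', ht1'⟩, hx', hy'⟩ h
    dsimp only [joinDist] at h ht0 ht1 ht0' ht1' hx hx' hy hy'
    have n1 : 0 ≤ L / 2 * |(1 - t) - (1 - t')| := by positivity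
    have n2 : 0 ≤ L / 2 * |t - t'| := by positivity
    have n3 : 0 ≤ min (1 - t) (1 - t') * min (dist x x') L :=
      mul_nonneg (le_min (by linarith) (by linarith)) (le_min dist_nonneg hL.le)
    have n4 : 0 ≤ min t t' * min (dist y y') L :=
      mul_nonneg (le_min ht0 ht0') (le_min dist_nonneg hL.le)
    have htt : t = t' := by
      have : L / 2 * |t - t'| = 0 := by linarith
      rcases mul_eq_zero.1 this with h | h
      · linarith
      · exact sub_eq_zero.1 (abs_eq_zero.1 h)
    have e3 : min (1 - t) (1 - t') * min (dist x x') L = 0 := by linarith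
    have e4 : min t t' * min (dist y y') L = 0 := by linarith
    subst htt
    rw [min_self] at e3 e4
    have hxx : x = x' := by
      rcases mul_eq_zero.1 e3 with h | h
      · exact (hx (by linarith)).trans (hx' (by linarith)).symm
      · exact eq_of_dist_eq_zero (by rcases min_cases (dist x x') L with h' | h' <;> linarith)
    have hyy : y = y' := by
      rcases mul_eq_zero.1 e4 with h | h
      · exact (hy h).trans (hy' h).symm
      · exact eq_of_dist_eq_zero (by rcases min_cases (dist y y') L with h' | h' <;> linarith)
    subst hxx hyy
    rfl

theorem dist_joinInl (x₀ : X) (y₀ : Y) {L : ℝ} (hL : 0 < L) (x x' : X) :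
    (joinMetric x₀ y₀ hL).dist (joinInl x₀ y₀ x) (joinInl x₀ y₀ x') = min (dist x x') L := by
  change joinDist L _ _ = _
  simp [joinDist, joinInl]

theorem dist_joinInr (x₀ : X) (y₀ : Y) {L : ℝ} (hL : 0 < L) (y y' : Y) :
    (joinMetric x₀ y₀ hL).dist (joinInr x₀ y₀ y) (joinInr x₀ y₀ y') = min (dist y y') L := by
  change joinDist L _ _ = _
  simp [joinDist, joinInr]

theorem dist_joinSegment (x₀ : X) (y₀ : Y) {L : ℝ} (hL : 0 < L) (x : X) (y : Y) {s t : ℝ}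
    (hs : s ∈ Icc (0 : ℝ) 1) (ht : t ∈ Icc (0 : ℝ) 1) :
    (joinMetric x₀ y₀ hL).dist (joinSegment x₀ y₀ x y s) (joinSegment x₀ y₀ x y t) =
      L * |s - t| := by
  classical
  have h1 : min (1 - s) (1 - t) *
      min (dist (if s = 1 then x₀ else x) (if t = 1 then x₀ else x)) L = 0 := by
    by_cases h : s = 1
    · simp [h, ht.2]
    by_cases h' : t = 1
    · simp [h', hs.2]
    simp [h, h', hL.le]
  have h2 : min s t *
      min (dist (if s = 0 then y₀ else y) (if t = 0 then y₀ else y)) L = 0 := by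
    by_cases h : s = 0
    · simp [h, ht.1]
    by_cases h' : t = 0
    · simp [h', hs.1]
    simp [h, h', hL.le]
  have h3 : |(1 - s) - (1 - t)| = |s - t| := by rw [abs_sub_comm s t]; congr 1; ring
  change joinDist L _ _ = _
  simp only [joinDist, joinSegment, projIcc_of_mem zero_le_one hs, projIcc_of_mem zero_le_one ht,
    h1, h2, h3]
  ring

end Join

/-- Let `X`, `Y` be rectifiable zigzag connected d-spaces whose zigzag
metric spaces are nonempty compact metric spaces (represented by `A` and `B`). For every
`ε > 0` there are a metric space `W` with a rectifiable d-structure `PW` and d-isometries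
`F : X → W`, `G : Y → W` such that the Hausdorff distance (w.r.t. `dZ^W`) between `F(X)`
and `G(Y)` is at most `d_GH((X, dZ^X), (Y, dZ^Y)) + ε`. -/
theorem exists_dIsometries_ehausdorffDist_le {X : Type u} {Y : Type v}
    [MetricSpace X] [MetricSpace Y] (PX : Set (ℝ → X)) (PY : Set (ℝ → Y))
    (hPX : IsDSpace PX) (hrX : IsRectifiable PX) (hcX : ZigzagConnected PX)
    (hPY : IsDSpace PY) (hrY : IsRectifiable PY) (hcY : ZigzagConnected PY)
    (A : Type*) [MetricSpace A] [CompactSpace A] [Nonempty A]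
    (φ : A ≃ X) (hφ : ∀ a a' : A, edist a a' = zzDist PX (φ a) (φ a'))
    (B : Type*) [MetricSpace B] [CompactSpace B] [Nonempty B]
    (ψ : B ≃ Y) (hψ : ∀ b b' : B, edist b b' = zzDist PY (ψ b) (ψ b'))
    (ε : ℝ) (hε : 0 < ε) :
    ∃ (W : Type (max u v)) (_ : MetricSpace W) (PW : Set (ℝ → W)),
      IsDSpace PW ∧ IsRectifiable PW ∧
      ∃ (F : X → W) (G : Y → W),
        IsDMap PX PW F ∧ (∀ x x' : X, zzDist PW (F x) (F x') = zzDist PX x x') ∧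
        IsDMap PY PW G ∧ (∀ y y' : Y, zzDist PW (G y) (G y') = zzDist PY y y') ∧
        ehausdorffDist (zzDist PW) (Set.range F) (Set.range G)
          ≤ ENNReal.ofReal (GromovHausdorff.ghDist A B + ε) := by
  obtain ⟨Φ, Ψ, hΦ, hΨ, hGH⟩ := GromovHausdorff.ghDist_eq_hausdorffDist A B
  set L := GromovHausdorff.ghDist A B + ε
  have hlt : Metric.hausdorffDist (Set.range Φ) (Set.range Ψ) < L := by rw [← hGH]; simp [L, hε]
  have hL : 0 < L := Metric.hausdorffDist_nonneg.trans_lt hlt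
  have hfin : Metric.hausdorffEDist (Set.range Φ) (Set.range Ψ) ≠ ⊤ :=
    Metric.hausdorffEDist_ne_top_of_nonempty_of_bounded (Set.range_nonempty _)
      (Set.range_nonempty _) (isCompact_range hΦ.continuous).isBounded
      (isCompact_range hΨ.continuous).isBounded
  set f := Φ ∘ φ.symm
  set g := Ψ ∘ ψ.symm
  have hf : ∀ x x', edist (f x) (f x') = zzDist PX x x' := fun x x' => by simp [f, hΦ.edist_eq, hφ]
  have hg : ∀ y y', edist (g y) (g y') = zzDist PY y y' := fun y y' => by simp [g, hΨ.edist_eq, hψ]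
  let x₀ : X := φ (Classical.arbitrary A)
  let y₀ : Y := ψ (Classical.arbitrary B)
  let _ : MetricSpace (Join x₀ y₀) := joinMetric x₀ y₀ hL
  have hF := isDMap_and_zzDist_eq hPX hrX (p := joinLift x₀ y₀ f g) hL (dist_joinInl x₀ y₀ hL)
    (fun x x' => by rw [joinLift_joinInl, joinLift_joinInl, hf])
  have hG := isDMap_and_zzDist_eq hPY hrY (p := joinLift x₀ y₀ f g) hL (dist_joinInr x₀ y₀ hL)
    (fun y y' => by rw [joinLift_joinInr, joinLift_joinInr, hg])
  have hseg : ∀ x y, dist (f x) (g y) ≤ L →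
      zzDist (controlledPaths (joinLift x₀ y₀ f g)) (joinInl x₀ y₀ x) (joinInr x₀ y₀ y) ≤
        ENNReal.ofReal L := fun x y hxy => by
    rw [← joinSegment_zero x₀ y₀ x y, ← joinSegment_one x₀ y₀ x y]
    exact zzDist_controlledPaths_le (fun s hs t ht => dist_joinSegment x₀ y₀ hL x y hs ht)
      (fun s hs t ht => edist_joinLift_joinSegment_le x₀ y₀ f g hxy hs ht)
  refine ⟨Join x₀ y₀, inferInstance, controlledPaths (joinLift x₀ y₀ f g),
    isDSpace_controlledPaths _, isRectifiable_controlledPaths _, joinInl x₀ y₀, joinInr x₀ y₀,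
    hF.1, hF.2, hG.1, hG.2, max_le (iSup₂_le ?_) (iSup₂_le ?_)⟩
  · rintro _ ⟨x, rfl⟩
    obtain ⟨_, ⟨b, rfl⟩, hb⟩ :=
      Metric.exists_dist_lt_of_hausdorffDist_lt (Set.mem_range_self (φ.symm x)) hlt hfin
    exact (iInf₂_le _ (Set.mem_range_self (ψ b))).trans (hseg _ _ (by simpa [f, g] using hb.le))
  · rintro _ ⟨y, rfl⟩
    obtain ⟨_, ⟨a, rfl⟩, ha⟩ :=
      Metric.exists_dist_lt_of_hausdorffDist_lt' (Set.mem_range_self (ψ.symm y)) hlt hfin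
    exact (iInf₂_le _ (Set.mem_range_self (φ a))).trans (hseg _ _ (by simpa [f, g] using ha.le))

end
end

section
/- Let (X, P(X)), (Y, P(Y)), (Z, P(Z)) be rectifiable d-spaces with induced zigzag distances dZ^X, dZ^Y, dZ^Z. Then the distortion distance satisfies the triangle inequality: d_dis(X, Z) ≤ d_dis(X, Y) + d_dis(Y, Z) (as values in [0,∞]). -/
open scoped ENNReal

noncomputable section

theorem ediffAbs_triangle (a b c : ℝ≥0∞) : ediffAbs a c ≤ ediffAbs a b + ediffAbs b c := by
  refine sup_le ?_ ?_
  · exact tsub_le_tsub_add_tsub.trans (add_le_add le_sup_left le_sup_left)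
  · refine (tsub_le_tsub_add_tsub (b := b)).trans ?_
    rw [add_comm]
    exact add_le_add le_sup_right le_sup_right

theorem ediffAbs_le_edis {X Y : Type*} (dX : X → X → ℝ≥0∞) (dY : Y → Y → ℝ≥0∞) (F : X → Y)
    (x x' : X) : ediffAbs (dX x x') (dY (F x) (F x')) ≤ edis dX dY F :=
  le_iSup₂ (f := fun x x' => ediffAbs (dX x x') (dY (F x) (F x'))) x x'

theorem ediffAbs_le_ecodis {X Y : Type*} (dX : X → X → ℝ≥0∞) (dY : Y → Y → ℝ≥0∞) (F : X → Y)
    (G : Y → X) (x : X) (y : Y) :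
    ediffAbs (dX x (G y)) (dY (F x) y) ≤ ecodis dX dY F G :=
  le_iSup₂ (f := fun x y => ediffAbs (dX x (G y)) (dY (F x) y)) x y

theorem edis_comp_le {X Y Z : Type*} (dX : X → X → ℝ≥0∞) (dY : Y → Y → ℝ≥0∞)
    (dZ : Z → Z → ℝ≥0∞) (F : X → Y) (F' : Y → Z) :
    edis dX dZ (F' ∘ F) ≤ edis dX dY F + edis dY dZ F' :=
  iSup₂_le fun x x' => (ediffAbs_triangle _ (dY (F x) (F x')) _).trans
    (add_le_add (ediffAbs_le_edis dX dY F x x') (ediffAbs_le_edis dY dZ F' (F x) (F x')))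

theorem ecodis_comp_le {X Y Z : Type*} (dX : X → X → ℝ≥0∞) (dY : Y → Y → ℝ≥0∞)
    (dZ : Z → Z → ℝ≥0∞) (F : X → Y) (G : Y → X) (F' : Y → Z) (G' : Z → Y) :
    ecodis dX dZ (F' ∘ F) (G ∘ G') ≤ ecodis dX dY F G + ecodis dY dZ F' G' :=
  iSup₂_le fun x z => (ediffAbs_triangle _ (dY (F x) (G' z)) _).trans
    (add_le_add (ediffAbs_le_ecodis dX dY F G x (G' z)) (ediffAbs_le_ecodis dY dZ F' G' (F x) z))

theorem IsDMap.comp {X Y Z : Type*} [MetricSpace X] [MetricSpace Y] [MetricSpace Z]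
    {PX : Set (ℝ → X)} {PY : Set (ℝ → Y)} {PZ : Set (ℝ → Z)} {F : X → Y} {F' : Y → Z}
    (hF' : IsDMap PY PZ F') (hF : IsDMap PX PY F) : IsDMap PX PZ (F' ∘ F) :=
  ⟨hF'.1.comp hF.1, fun γ hγ => hF'.2 _ (hF.2 γ hγ)⟩

/-- The distortion distance between rectifiable d-spaces satisfies the
triangle inequality. -/
theorem ddis_triangle {X Y Z : Type*} [MetricSpace X] [MetricSpace Y] [MetricSpace Z]
    (PX : Set (ℝ → X)) (PY : Set (ℝ → Y)) (PZ : Set (ℝ → Z))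
    (hPX : IsDSpace PX) (hrX : IsRectifiable PX)
    (hPY : IsDSpace PY) (hrY : IsRectifiable PY)
    (hPZ : IsDSpace PZ) (hrZ : IsRectifiable PZ) :
    ddis PX PZ ≤ ddis PX PY + ddis PY PZ := by
  unfold ddis
  rw [← mul_add]
  gcongr
  simp_rw [ENNReal.iInf_add, ENNReal.add_iInf]
  refine le_iInf fun F => le_iInf fun G => le_iInf fun F' => le_iInf fun G' => ?_
  refine (iInf₂_le (⟨_, F'.2.comp F.2⟩ : {F : X → Z // IsDMap PX PZ F})
    (⟨_, G.2.comp G'.2⟩ : {G : Z → X // IsDMap PZ PX G})).trans ?_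
  refine max_le ?_ (max_le ?_ ?_)
  · exact (edis_comp_le _ (zzDist PY) _ _ _).trans
      (add_le_add (le_max_left _ _) (le_max_left _ _))
  · refine (edis_comp_le _ (zzDist PY) _ _ _).trans ?_
    rw [add_comm]
    exact add_le_add (le_max_of_le_right (le_max_left _ _))
      (le_max_of_le_right (le_max_left _ _))
  · exact (ecodis_comp_le _ (zzDist PY) _ _ _ _ _).trans
      (add_le_add (le_max_of_le_right (le_max_right _ _))
        (le_max_of_le_right (le_max_right _ _)))

end
end

section
/- Let (X, P(X)) and (Y, P(Y)) be rectifiable d-spaces with induced zigzag distances dZ^X and dZ^Y. There exist d-maps F : X → Y and G : Y → X with dis(F) = dis(G) = codis(F, G) = 0 if and only if X and Y are d-isometric, i.e., there exists a bijective d-isometry F : X → Y whose inverse is also a d-map. -/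
open scoped ENNReal

noncomputable section

theorem edist_zero_one_le_pathLen {X : Type*} [PseudoEMetricSpace X] (γ : ℝ → X) :
    edist (γ 0) (γ 1) ≤ pathLen γ :=
  eVariationOn.edist_le γ (by simp) (by simp)

theorem edist_le_pathLen_of_isDPathFrom_or {X : Type*} [PseudoEMetricSpace X]
    {P : Set (ℝ → X)} {x x' : X} {γ : ℝ → X}
    (h : IsDPathFrom P x x' γ ∨ IsDPathFrom P x' x γ) : edist x x' ≤ pathLen γ := by
  rcases h with ⟨-, rfl, rfl⟩ | ⟨-, rfl, rfl⟩
  · exact edist_zero_one_le_pathLen γ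
  · rw [edist_comm]
    exact edist_zero_one_le_pathLen γ

theorem edist_le_zigzagLen {X : Type*} [PseudoEMetricSpace X] {P : Set (ℝ → X)}
    {x x' : X} {L : List (ℝ → X)} (h : IsZigzagFrom P x x' L) :
    edist x x' ≤ zigzagLen L := by
  obtain ⟨p, rfl, rfl, hp⟩ := h
  calc edist (p 0) (p L.length)
      ≤ ∑ i ∈ Finset.range L.length, edist (p i) (p (i + 1)) :=
        edist_le_range_sum_edist p L.length
    _ = ∑ i : Fin L.length, edist (p i) (p (i + 1)) :=
        (Fin.sum_univ_eq_sum_range (fun i => edist (p i) (p (i + 1))) L.length).symm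
    _ ≤ ∑ i : Fin L.length, pathLen (L.get i) :=
        Finset.sum_le_sum fun i _ => edist_le_pathLen_of_isDPathFrom_or (hp i)
    _ = zigzagLen L := by simp [zigzagLen, Fin.sum_univ_fun_getElem]

theorem edist_le_zzDist_s9 {X : Type*} [MetricSpace X] (P : Set (ℝ → X)) (x x' : X) :
    edist x x' ≤ zzDist P x x' :=
  le_iInf₂ fun _ hL => edist_le_zigzagLen hL

theorem zzDist_self {X : Type*} [MetricSpace X] (P : Set (ℝ → X)) (x : X) :
    zzDist P x x = 0 :=
  nonpos_iff_eq_zero.mp <|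
    (iInf₂_le [] ⟨fun _ => x, rfl, rfl, fun i => i.elim0⟩).trans (by simp [zigzagLen])

theorem eq_of_zzDist_eq_zero {X : Type*} [MetricSpace X] {P : Set (ℝ → X)} {x x' : X}
    (h : zzDist P x x' = 0) : x = x' :=
  edist_le_zero.mp ((edist_le_zzDist_s9 P x x').trans h.le)

theorem ediffAbs_eq_zero {a b : ℝ≥0∞} : ediffAbs a b = 0 ↔ a = b := by
  rw [ediffAbs, ← bot_eq_zero, sup_eq_bot_iff, bot_eq_zero, tsub_eq_zero_iff_le,
    tsub_eq_zero_iff_le, le_antisymm_iff]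

theorem edis_eq_zero {X Y : Type*} {dX : X → X → ℝ≥0∞} {dY : Y → Y → ℝ≥0∞} {F : X → Y} :
    edis dX dY F = 0 ↔ ∀ x x', dX x x' = dY (F x) (F x') := by
  simp [edis, ediffAbs_eq_zero]

theorem ecodis_eq_zero {X Y : Type*} {dX : X → X → ℝ≥0∞} {dY : Y → Y → ℝ≥0∞}
    {F : X → Y} {G : Y → X} :
    ecodis dX dY F G = 0 ↔ ∀ x y, dX x (G y) = dY (F x) y := by
  simp [ecodis, ediffAbs_eq_zero]

/-- There exist d-maps `F : X → Y` and `G : Y → X` with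
`dis F = dis G = codis (F, G) = 0` (w.r.t. the zigzag distances) if and only if `X` and
`Y` are d-isometric, i.e. there is a bijective d-isometry whose inverse is also a d-map. -/
theorem dis_codis_zero_iff_dIsometric {X Y : Type*} [MetricSpace X] [MetricSpace Y]
    (PX : Set (ℝ → X)) (PY : Set (ℝ → Y))
    (hPX : IsDSpace PX) (hrX : IsRectifiable PX)
    (hPY : IsDSpace PY) (hrY : IsRectifiable PY) :
    (∃ (F : X → Y) (G : Y → X), IsDMap PX PY F ∧ IsDMap PY PX G ∧
        edis (zzDist PX) (zzDist PY) F = 0 ∧ edis (zzDist PY) (zzDist PX) G = 0 ∧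
        ecodis (zzDist PX) (zzDist PY) F G = 0) ↔
      (∃ F : X → Y, IsDMap PX PY F ∧ Function.Bijective F ∧
        (∀ x x' : X, zzDist PY (F x) (F x') = zzDist PX x x') ∧
        ∃ G : Y → X, IsDMap PY PX G ∧
          Function.LeftInverse G F ∧ Function.RightInverse G F) := by
  simp only [edis_eq_zero, ecodis_eq_zero]
  constructor
  · rintro ⟨F, G, hF, hG, hdF, -, hFG⟩
    have hl : Function.LeftInverse G F := fun x =>
      (eq_of_zzDist_eq_zero ((hFG x (F x)).trans (zzDist_self PY (F x)))).symm
    have hr : Function.RightInverse G F := fun y =>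
      eq_of_zzDist_eq_zero ((hFG (G y) y).symm.trans (zzDist_self PX (G y)))
    exact ⟨F, hF, ⟨hl.injective, hr.surjective⟩, fun x x' => (hdF x x').symm, G, hG, hl, hr⟩
  · rintro ⟨F, hF, -, hd, G, hG, -, hr⟩
    refine ⟨F, G, hF, hG, fun x x' => (hd x x').symm, fun y y' => ?_, fun x y => ?_⟩
    · rw [← hd, hr y, hr y']
    · rw [← hd, hr y]

end
end

section
/- Let (X, P(X)) and (Y, P(Y)) be rectifiable, zigzag connected d-spaces such that (X, dZ^X) and (Y, dZ^Y) are nonempty compact metric spaces. Then d_GH((X, dZ^X), (Y, dZ^Y)) ≤ d_dis(X, Y). -/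
open scoped ENNReal

noncomputable section

/-- Half the distortion of a correspondence, parametrized by two surjections `Φ` and `Ψ`, bounds
the Gromov–Hausdorff distance. -/
theorem ghDist_le_half_of_surjective {A B Z : Type*} [MetricSpace A] [CompactSpace A] [Nonempty A]
    [MetricSpace B] [CompactSpace B] [Nonempty B] {Φ : Z → A} {Ψ : Z → B}
    (hΦ : Function.Surjective Φ) (hΨ : Function.Surjective Ψ) {r : ℝ}
    (h : ∀ p q, |dist (Φ p) (Φ q) - dist (Ψ p) (Ψ q)| ≤ r) :
    GromovHausdorff.ghDist A B ≤ r / 2 := by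
  have : Nonempty Z := (hΦ (Classical.arbitrary A)).nonempty
  have hr : 0 ≤ r := (abs_nonneg _).trans (h (Classical.arbitrary Z) (Classical.arbitrary Z))
  refine le_of_forall_pos_le_add fun δ hδ => ?_
  let _ : MetricSpace (A ⊕ B) :=
    Metric.glueMetricApprox Φ Ψ (r / 2 + δ) (by linarith) fun p q => (h p q).trans (by linarith)
  have hglue (p : Z) : dist (Sum.inl (Φ p) : A ⊕ B) (Sum.inr (Ψ p)) ≤ r / 2 + δ :=
    (Metric.glueDist_glued_points Φ Ψ (r / 2 + δ) p).le
  have hl : Isometry (Sum.inl : A → A ⊕ B) := Isometry.of_dist_eq fun _ _ => rfl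
  have hr' : Isometry (Sum.inr : B → A ⊕ B) := Isometry.of_dist_eq fun _ _ => rfl
  refine (GromovHausdorff.ghDist_le_hausdorffDist hl hr').trans
    (Metric.hausdorffDist_le_of_mem_dist (by linarith) ?_ ?_)
  · rintro _ ⟨a, rfl⟩
    obtain ⟨p, rfl⟩ := hΦ a
    exact ⟨_, ⟨Ψ p, rfl⟩, hglue p⟩
  · rintro _ ⟨b, rfl⟩
    obtain ⟨p, rfl⟩ := hΨ b
    exact ⟨_, ⟨Φ p, rfl⟩, (dist_comm _ _).trans_le (hglue p)⟩

theorem ediffAbs_comm (a b : ℝ≥0∞) : ediffAbs a b = ediffAbs b a :=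
  sup_comm _ _

theorem abs_dist_sub_dist_le_of_ediffAbs_le {A B : Type*} [PseudoMetricSpace A]
    [PseudoMetricSpace B] {a a' : A} {b b' : B} {M : ℝ≥0∞} (hM : M ≠ ⊤)
    (h : ediffAbs (edist a a') (edist b b') ≤ M) :
    |dist a a' - dist b b'| ≤ M.toReal := by
  obtain ⟨h₁, h₂⟩ := sup_le_iff.1 h
  rw [tsub_le_iff_right] at h₁ h₂
  have h₁ := ENNReal.toReal_mono (ENNReal.add_ne_top.2 ⟨hM, edist_ne_top _ _⟩) h₁
  have h₂ := ENNReal.toReal_mono (ENNReal.add_ne_top.2 ⟨hM, edist_ne_top _ _⟩) h₂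
  rw [ENNReal.toReal_add hM (edist_ne_top _ _), ← dist_edist, ← dist_edist] at h₁ h₂
  exact abs_le.2 ⟨by linarith, by linarith⟩

/-- The Gromov–Hausdorff distance of compact metric spaces is at most half the maximum of the
distortions and the codistortion of any pair of maps between them. -/
theorem ofReal_ghDist_le_half_max_edis_ecodis {A B : Type*} [MetricSpace A] [CompactSpace A]
    [Nonempty A] [MetricSpace B] [CompactSpace B] [Nonempty B] (f : A → B) (g : B → A) :
    ENNReal.ofReal (GromovHausdorff.ghDist A B) ≤
      (1 / 2 : ℝ≥0∞) * max (edis edist edist f) (max (edis edist edist g)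
        (ecodis edist edist f g)) := by
  set M := max (edis edist edist f) (max (edis edist edist g) (ecodis edist edist f g))
  by_cases hM : M = ⊤
  · simp [hM]
  have hf : edis edist edist f ≤ M := le_max_left _ _
  have hg : edis edist edist g ≤ M := (le_max_left _ _).trans (le_max_right _ _)
  have hfg : ecodis edist edist f g ≤ M := (le_max_right _ _).trans (le_max_right _ _)
  have key : GromovHausdorff.ghDist A B ≤ M.toReal / 2 := by
    refine ghDist_le_half_of_surjective (Φ := Sum.elim id g) (Ψ := Sum.elim f id)
      (fun a => ⟨.inl a, rfl⟩) (fun b => ⟨.inr b, rfl⟩) ?_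
    rintro (a | b) (a' | b') <;>
      refine abs_dist_sub_dist_le_of_ediffAbs_le hM ?_ <;>
      simp only [Sum.elim_inl, Sum.elim_inr, id_eq]
    · exact (ediffAbs_le_edis edist edist f a a').trans hf
    · exact (ediffAbs_le_ecodis edist edist f g a b').trans hfg
    · rw [edist_comm (g b), edist_comm b]
      exact (ediffAbs_le_ecodis edist edist f g a' b).trans hfg
    · rw [ediffAbs_comm]
      exact (ediffAbs_le_edis edist edist g b b').trans hg
  refine (ENNReal.ofReal_le_ofReal key).trans_eq ?_
  rw [ENNReal.ofReal_div_of_pos two_pos, ENNReal.ofReal_toReal hM, ENNReal.ofReal_ofNat,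
    ENNReal.div_eq_inv_mul, one_div]

/-- For rectifiable zigzag connected d-spaces whose zigzag metric
spaces are nonempty compact metric spaces (represented by `A` and `B`), the
Gromov–Hausdorff distance between the zigzag metric spaces is at most the distortion
distance. -/
theorem ghDist_le_ddis {X Y : Type*} [MetricSpace X] [MetricSpace Y]
    (PX : Set (ℝ → X)) (PY : Set (ℝ → Y))
    (hPX : IsDSpace PX) (hrX : IsRectifiable PX) (hcX : ZigzagConnected PX)
    (hPY : IsDSpace PY) (hrY : IsRectifiable PY) (hcY : ZigzagConnected PY)
    (A : Type*) [MetricSpace A] [CompactSpace A] [Nonempty A]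
    (φ : A ≃ X) (hφ : ∀ a a' : A, edist a a' = zzDist PX (φ a) (φ a'))
    (B : Type*) [MetricSpace B] [CompactSpace B] [Nonempty B]
    (ψ : B ≃ Y) (hψ : ∀ b b' : B, edist b b' = zzDist PY (ψ b) (ψ b')) :
    ENNReal.ofReal (GromovHausdorff.ghDist A B) ≤ ddis PX PY := by
  rw [ddis, ENNReal.mul_iInf_of_ne (by simp) (by simp)]
  refine le_iInf fun F => ?_
  rw [ENNReal.mul_iInf_of_ne (by simp) (by simp)]
  refine le_iInf fun G => (ofReal_ghDist_le_half_max_edis_ecodis (fun a => ψ.symm (F.1 (φ a)))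
    (fun b => φ.symm (G.1 (ψ b)))).trans ?_
  gcongr
  · refine iSup₂_le fun a a' => ?_
    simpa [hφ, hψ] using ediffAbs_le_edis (zzDist PX) (zzDist PY) F.1 (φ a) (φ a')
  · refine iSup₂_le fun b b' => ?_
    simpa [hφ, hψ] using ediffAbs_le_edis (zzDist PY) (zzDist PX) G.1 (ψ b) (ψ b')
  · refine iSup₂_le fun a b => ?_
    simpa [hφ, hψ] using ediffAbs_le_ecodis (zzDist PX) (zzDist PY) F.1 G.1 (φ a) (ψ b)

end
end

section
/- Let X = [−1,1] with the Euclidean metric, let P(X) be the smallest d-structure containing the paths γ1(t) = t and γ2(t) = −t, and let X* be the reversed d-space. Then there exists no d-correspondence between X and X*; consequently, the d-correspondence distortion distance satisfies d_cdis(X, X*) = ∞, while d_dis(X, X*) < ∞. -/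
open scoped ENNReal

noncomputable section

/-- The interval `[-1, 1]` with the Euclidean metric. -/
abbrev MInt : Type := {x : ℝ // x ∈ Set.Icc (-1:ℝ) 1}

/-- Clamp a real number into `[-1, 1]`. -/
def clampM (t : ℝ) : MInt :=
  ⟨max (-1) (min 1 t), ⟨le_max_left _ _, max_le (by norm_num) (min_le_left _ _)⟩⟩

/-- The path `γ₁(t) = t` (for `t ∈ [0,1]`). -/
def gone : ℝ → MInt := fun t => clampM t

/-- The path `γ₂(t) = -t` (for `t ∈ [0,1]`). -/
def gtwo : ℝ → MInt := fun t => clampM (-t)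

/-- The smallest d-structure on `[-1,1]` containing `γ₁` and `γ₂`: the intersection of all
d-structures containing them. -/
def mintP : Set (ℝ → MInt) :=
  ⋂₀ {P : Set (ℝ → MInt) | IsDSpace P ∧ {gone, gtwo} ⊆ P}

/-- Reachability in the d-structure generated by `gone` and `gtwo`. -/
def OutwardRel (x y : MInt) : Prop :=
  x = y ∨ (0 ≤ x.1 ∧ x.1 ≤ y.1) ∨ (y.1 ≤ x.1 ∧ x.1 ≤ 0)

theorem OutwardRel.trans {x y z : MInt} (hxy : OutwardRel x y) (hyz : OutwardRel y z) :
    OutwardRel x z := by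
  unfold OutwardRel at *
  simp only [Subtype.ext_iff] at *
  grind

/-- Continuous paths moving only in the direction of `OutwardRel`. -/
def outwardPaths : Set (ℝ → MInt) :=
  {γ | ContinuousOn γ (Set.Icc 0 1) ∧
    ∀ s ∈ Set.Icc (0:ℝ) 1, ∀ t ∈ Set.Icc (0:ℝ) 1, s ≤ t → OutwardRel (γ s) (γ t)}

theorem lipschitzWith_clampM : LipschitzWith 1 clampM :=
  LipschitzWith.projIcc (by norm_num : (-1:ℝ) ≤ 1)

theorem clampM_coe (x : MInt) : clampM x.1 = x :=
  Subtype.ext (by simp [clampM, x.2.1, x.2.2])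

theorem continuousOn_concat {X : Type*} [TopologicalSpace X] {γ γ' : ℝ → X}
    (hγ : ContinuousOn γ (Set.Icc 0 1)) (hγ' : ContinuousOn γ' (Set.Icc 0 1))
    (h : γ 1 = γ' 0) :
    ContinuousOn (fun t : ℝ => if t ≤ 1/2 then γ (2*t) else γ' (2*t - 1)) (Set.Icc 0 1) := by
  have hsplit : Set.Icc (0:ℝ) 1 = Set.Icc 0 (1/2) ∪ Set.Icc (1/2) 1 :=
    (Set.Icc_union_Icc_eq_Icc (by norm_num) (by norm_num)).symm
  rw [hsplit]
  refine ContinuousOn.union_of_isClosed ?_ ?_ isClosed_Icc isClosed_Icc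
  · refine (hγ.comp (f := fun t : ℝ => 2 * t) (by fun_prop) ?_).congr ?_
    · intro t ht
      constructor <;> linarith [ht.1, ht.2]
    · intro t ht
      simp [show t ≤ 2⁻¹ by linarith [ht.2]]
  · refine (hγ'.comp (f := fun t : ℝ => 2 * t - 1) (by fun_prop) ?_).congr ?_
    · intro t ht
      constructor <;> linarith [ht.1, ht.2]
    · intro t ht
      rcases ht.1.eq_or_lt with rfl | hlt
      · simpa using h
      · simp only [if_neg (not_le.mpr hlt), Function.comp_apply]

theorem isDSpace_outwardPaths : IsDSpace outwardPaths where
  cont γ hγ := hγ.1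
  const_mem x := ⟨continuousOn_const, fun _ _ _ _ _ => Or.inl rfl⟩
  reparam γ hγ h hc hm hmaps :=
    ⟨hγ.1.comp hc hmaps, fun s hs t ht hst => hγ.2 _ (hmaps hs) _ (hmaps ht) (hm hs ht hst)⟩
  concat γ hγ γ' hγ' h := by
    refine ⟨continuousOn_concat hγ.1 hγ'.1 h, fun s hs t ht hst => ?_⟩
    have hs' := hs.1
    have ht' := ht.2
    dsimp only
    split_ifs with h1 h2 h2
    · exact hγ.2 _ ⟨by linarith, by linarith⟩ _ ⟨by linarith, by linarith⟩ (by linarith)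
    · have hleft := hγ.2 (2 * s) ⟨by linarith, by linarith⟩ 1 (by simp) (by linarith)
      rw [h] at hleft
      exact hleft.trans
        (hγ'.2 0 (by simp) (2 * t - 1) ⟨by linarith, by linarith⟩ (by linarith))
    · linarith
    · exact hγ'.2 _ ⟨by linarith, by linarith⟩ _ ⟨by linarith, by linarith⟩ (by linarith)

theorem mintP_subset_outwardPaths : mintP ⊆ outwardPaths := by
  refine Set.sInter_subset_of_mem ⟨isDSpace_outwardPaths, ?_⟩
  rintro γ (rfl | rfl)
  · refine ⟨lipschitzWith_clampM.continuous.continuousOn, fun s hs t ht hst => ?_⟩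
    refine Or.inr (Or.inl ?_)
    simp only [gone, clampM, min_eq_right hs.2, min_eq_right ht.2,
      max_eq_right (show (-1:ℝ) ≤ s by linarith [hs.1]),
      max_eq_right (show (-1:ℝ) ≤ t by linarith [ht.1])]
    exact ⟨hs.1, hst⟩
  · refine ⟨(lipschitzWith_clampM.continuous.comp continuous_neg).continuousOn,
      fun s hs t ht hst => ?_⟩
    refine Or.inr (Or.inr ?_)
    simp only [gtwo, clampM, min_eq_right (show -s ≤ 1 by linarith [hs.1]),
      min_eq_right (show -t ≤ 1 by linarith [ht.1]),
      max_eq_right (show (-1:ℝ) ≤ -s by linarith [hs.2]),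
      max_eq_right (show (-1:ℝ) ≤ -t by linarith [ht.2])]
    exact ⟨by linarith, by linarith [hs.1]⟩

theorem outwardRel_of_isDPathFrom {x y : MInt} {γ : ℝ → MInt} (h : IsDPathFrom mintP x y γ) :
    OutwardRel x y := by
  obtain ⟨hγ, rfl, rfl⟩ := h
  exact (mintP_subset_outwardPaths hγ).2 0 (by simp) 1 (by simp) zero_le_one

theorem const_mem_mintP (x : MInt) : (fun _ : ℝ => x) ∈ mintP :=
  fun _ hP => hP.1.const_mem x

/-- The straight path from the origin to `x`. -/
def radialPath (x : MInt) : ℝ → MInt := fun t => clampM (x.1 * t)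

theorem radialPath_mem (x : MInt) : radialPath x ∈ mintP := by
  rintro P ⟨hP, hsub⟩
  rcases le_total 0 x.1 with hx | hx
  · refine hP.reparam gone (hsub (by simp)) (fun t => x.1 * t) (by fun_prop)
      (fun s _ t _ hst => mul_le_mul_of_nonneg_left hst hx) fun t ht => ?_
    exact ⟨mul_nonneg hx ht.1, mul_le_one₀ x.2.2 ht.1 ht.2⟩
  · have hx' : 0 ≤ -x.1 := by linarith
    have heq : radialPath x = gtwo ∘ fun t => -x.1 * t := by
      funext t
      simp [radialPath, gtwo]
    rw [heq]
    refine hP.reparam gtwo (hsub (by simp)) (fun t => -x.1 * t) (by fun_prop)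
      (fun s _ t _ hst => mul_le_mul_of_nonneg_left hst hx') fun t ht => ?_
    exact ⟨mul_nonneg hx' ht.1, mul_le_one₀ (by linarith [x.2.1]) ht.1 ht.2⟩

theorem lipschitzWith_radialPath (x : MInt) : LipschitzWith 1 (radialPath x) := by
  have hmul : LipschitzWith 1 fun t : ℝ => x.1 * t := by
    refine LipschitzWith.of_dist_le_mul fun s t => ?_
    rw [Real.dist_eq, Real.dist_eq, ← mul_sub, abs_mul]
    exact mul_le_mul_of_nonneg_right (abs_le.mpr x.2) (abs_nonneg _)
  have h := lipschitzWith_clampM.comp hmul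
  rwa [one_mul] at h

theorem isDPathFrom_radialPath (x : MInt) : IsDPathFrom mintP (clampM 0) x (radialPath x) :=
  ⟨radialPath_mem x, by simp [radialPath], by simp [radialPath, clampM_coe]⟩

theorem isDPathFrom_reverseP {X : Type*} {P : Set (ℝ → X)} {x y : X} {γ : ℝ → X}
    (h : IsDPathFrom P x y γ) : IsDPathFrom (reverseP P) y x fun t => γ (1 - t) :=
  ⟨by simpa [reverseP] using h.1, by simp [h.2.2], by simp [h.2.1]⟩

theorem pathLen_le_one_of_lipschitzWith {X : Type*} [PseudoEMetricSpace X] {γ : ℝ → X}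
    (h : LipschitzWith 1 γ) : pathLen γ ≤ 1 := by
  refine (h.lipschitzOnWith (s := Set.univ)).comp_eVariationOn_le (g := id)
    (s := Set.Icc (0:ℝ) 1) (Set.mapsTo_univ _ _) |>.trans ?_
  simp

/-- If every point is joined to a fixed basepoint by a single d-path of length at most one,
then the zigzag distance is bounded by two. -/
theorem zzDist_le_two {X : Type*} [MetricSpace X] {P : Set (ℝ → X)} {o : X}
    (h : ∀ x, ∃ γ, (IsDPathFrom P o x γ ∨ IsDPathFrom P x o γ) ∧ pathLen γ ≤ 1) (x y : X) :
    zzDist P x y ≤ 2 := by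
  obtain ⟨γ, hγ, hlen⟩ := h x
  obtain ⟨γ', hγ', hlen'⟩ := h y
  have hz : IsZigzagFrom P x y [γ, γ'] := by
    refine ⟨fun n => if n = 0 then x else if n = 1 then o else y, by simp, by simp, ?_⟩
    intro i
    fin_cases i
    · simpa using hγ.symm
    · simpa using hγ'
  refine (iInf₂_le [γ, γ'] hz).trans ?_
  simpa [zigzagLen, one_add_one_eq_two] using add_le_add hlen hlen'

theorem zzDist_mintP_le_two (x y : MInt) : zzDist mintP x y ≤ 2 :=
  zzDist_le_two (fun z => ⟨radialPath z, Or.inl (isDPathFrom_radialPath z),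
    pathLen_le_one_of_lipschitzWith (lipschitzWith_radialPath z)⟩) x y

theorem zzDist_reverseP_mintP_le_two (x y : MInt) : zzDist (reverseP mintP) x y ≤ 2 := by
  refine zzDist_le_two (fun z => ⟨_, Or.inr (isDPathFrom_reverseP (isDPathFrom_radialPath z)),
    pathLen_le_one_of_lipschitzWith ?_⟩) x y
  have hsub : LipschitzWith 1 fun t : ℝ => 1 - t :=
    LipschitzWith.of_dist_le_mul fun s t => by
      rw [NNReal.coe_one, one_mul, dist_sub_left]
  have h := (lipschitzWith_radialPath z).comp hsub
  rwa [one_mul] at h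

theorem ediffAbs_le {a b c : ℝ≥0∞} (ha : a ≤ c) (hb : b ≤ c) : ediffAbs a b ≤ c :=
  sup_le (tsub_le_self.trans ha) (tsub_le_self.trans hb)

theorem not_exists_isDCorrespondence_mintP :
    ¬ ∃ R : Set (MInt × MInt), IsDCorrespondence mintP (reverseP mintP) R := by
  rintro ⟨R, hleft, hright, hR⟩
  obtain ⟨y, hy⟩ := hleft (clampM 0)
  have hrel : ∀ z : MInt, OutwardRel z y := by
    intro z
    obtain ⟨x, hx⟩ := hright z
    obtain ⟨γ, hγ, h0, h1⟩ := (hR _ hy _ hx).mp ⟨_, isDPathFrom_radialPath x⟩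
    exact outwardRel_of_isDPathFrom ⟨hγ, by simpa using h1, by simpa using h0⟩
  have h1 := hrel ⟨1, by norm_num⟩
  have h2 := hrel ⟨-1, by norm_num⟩
  simp only [OutwardRel, Subtype.ext_iff] at h1 h2
  grind

theorem ddis_mintP_reverseP_le_two : ddis mintP (reverseP mintP) ≤ 2 := by
  have hF : IsDMap mintP (reverseP mintP) fun _ => clampM 0 :=
    ⟨continuous_const, fun _ _ => const_mem_mintP _⟩
  have hG : IsDMap (reverseP mintP) mintP fun _ => clampM 0 :=
    ⟨continuous_const, fun _ _ => const_mem_mintP _⟩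
  refine (mul_le_of_le_one_left zero_le (by simp)).trans ?_
  refine (iInf₂_le (⟨_, hF⟩ : {F : MInt → MInt // IsDMap mintP (reverseP mintP) F})
    (⟨_, hG⟩ : {G : MInt → MInt // IsDMap (reverseP mintP) mintP G})).trans ?_
  refine max_le ?_ (max_le ?_ ?_)
  · exact iSup₂_le fun _ _ =>
      ediffAbs_le (zzDist_mintP_le_two _ _) (zzDist_reverseP_mintP_le_two _ _)
  · exact iSup₂_le fun _ _ =>
      ediffAbs_le (zzDist_reverseP_mintP_le_two _ _) (zzDist_mintP_le_two _ _)
  · exact iSup₂_le fun _ _ =>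
      ediffAbs_le (zzDist_mintP_le_two _ _) (zzDist_reverseP_mintP_le_two _ _)

/-- There is no d-correspondence between `X = ([-1,1], ⟨γ₁, γ₂⟩)` and
its reversed d-space `X*`; hence `d_cdis(X, X*) = ∞`, while `d_dis(X, X*) < ∞`. -/
theorem no_dCorrespondence_mint_reverse :
    (¬ ∃ R : Set (MInt × MInt), IsDCorrespondence mintP (reverseP mintP) R) ∧
    dcdis mintP (reverseP mintP) = ⊤ ∧ ddis mintP (reverseP mintP) < ⊤ := by
  refine ⟨not_exists_isDCorrespondence_mintP, ?_,
    ddis_mintP_reverseP_le_two.trans_lt ENNReal.ofNat_lt_top⟩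
  have hempty : IsEmpty {R : Set (MInt × MInt) // IsDCorrespondence mintP (reverseP mintP) R} :=
    ⟨fun R => not_exists_isDCorrespondence_mintP ⟨R.1, R.2⟩⟩
  simp [dcdis, iInf_of_empty]

end
end
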